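/- Define a_n := c(n, n−2) − S(n, n−1)·S(n−1, 2) + S(n, 3) + S(n, 4) for n ≥ 1. Then, as formal power series in u, (1−u)⁵ (1−2u)³ (1−4u) · ∑_{n≥1} a_n u^n = 15u⁶ − 50u⁷ + 40u⁸ + 4u⁹; equivalently, ∑_{n≥1} a_n u^n = (15u⁶ − 50u⁷ + 40u⁸ + 4u⁹) / ((1−u)⁵(1−2u)³(1−4u)). -/

import Mathlib

/-- The Stirling number of the second kind `S(n,k)`: the number of partitions of an
`n`-element set into `k` nonempty blocks, i.e. the number of surjections `[n] ↠ [k]`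
divided by `k!`. -/
noncomputable def stirlingSnd (n k : ℕ) : ℕ :=
  Nat.card {f : Fin n → Fin k // Function.Surjective f} / k.factorial

/-- The number of cycles of a permutation (fixed points counting as cycles). -/
noncomputable def cycleCount {n : ℕ} (σ : Equiv.Perm (Fin n)) : ℕ :=
  σ.cycleType.card + (Finset.univ.filter fun x => σ x = x).card

/-- The unsigned Stirling number of the first kind `c(n,k)`: the number of permutations
of `[n]` with exactly `k` cycles. -/
noncomputable def stirlingFst (n k : ℕ) : ℕ :=
  Nat.card {σ : Equiv.Perm (Fin n) // cycleCount σ = k}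

/-- `a_n = c(n, n−2) − S(n, n−1)·S(n−1, 2) + S(n, 3) + S(n, 4)`
(the dimension of the degree-2 Kazhdan–Lusztig coefficient of the braid matroid). -/
noncomputable def braidKLdim2 (n : ℕ) : ℚ :=
  (stirlingFst n (n - 2) : ℚ) - stirlingSnd n (n - 1) * stirlingSnd (n - 1) 2 +
    stirlingSnd n 3 + stirlingSnd n 4

def surjMap (n k : ℕ) : Fin (k+1) × ({g : Fin n → Fin (k+1) // Function.Surjective g} ⊕
    {h : Fin n → Fin k // Function.Surjective h}) →
    {f : Fin (n+1) → Fin (k+1) // Function.Surjective f}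
  | (a, Sum.inl g) => ⟨Fin.cons a g.1, fun b => by
      obtain ⟨i, hi⟩ := g.2 b
      exact ⟨i.succ, by simpa using hi⟩⟩
  | (a, Sum.inr h) => ⟨Fin.cons a (a.succAbove ∘ h.1), fun b => by
      by_cases hb : b = a
      · exact ⟨0, by simp [hb]⟩
      · obtain ⟨c, hc⟩ := Fin.exists_succAbove_eq hb
        obtain ⟨i, hi⟩ := h.2 c
        exact ⟨i.succ, by simp [hi, hc]⟩⟩

theorem surjMap_bij (n k : ℕ) : Function.Bijective (surjMap n k) := by
  constructor
  · rintro ⟨a, g | g⟩ ⟨b, h | h⟩ e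
    · have e' : (Fin.cons a g.1 : Fin (n+1) → Fin (k+1)) = Fin.cons b h.1 := congrArg Subtype.val e
      rw [Fin.cons_inj] at e'
      obtain ⟨rfl, e2⟩ := e'
      rw [Subtype.ext e2]
    · exfalso
      have e' : (Fin.cons a g.1 : Fin (n+1) → Fin (k+1)) = Fin.cons b (b.succAbove ∘ h.1) :=
        congrArg Subtype.val e
      rw [Fin.cons_inj] at e'
      obtain ⟨i, hi⟩ := g.2 b
      rw [e'.2] at hi
      exact Fin.succAbove_ne _ _ hi
    · exfalso
      have e' : (Fin.cons a (a.succAbove ∘ g.1) : Fin (n+1) → Fin (k+1)) = Fin.cons b h.1 :=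
        congrArg Subtype.val e
      rw [Fin.cons_inj] at e'
      obtain ⟨i, hi⟩ := h.2 a
      rw [← e'.2] at hi
      exact Fin.succAbove_ne _ _ hi
    · have e' : (Fin.cons a (a.succAbove ∘ g.1) : Fin (n+1) → Fin (k+1)) =
        Fin.cons b (b.succAbove ∘ h.1) := congrArg Subtype.val e
      rw [Fin.cons_inj] at e'
      obtain ⟨rfl, e2⟩ := e'
      have : g = h := by
        apply Subtype.ext
        funext i
        exact Fin.succAbove_right_injective (congrFun e2 i)
      rw [this]
  · rintro ⟨f, hf⟩
    by_cases ht : Function.Surjective (Fin.tail f)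
    · refine ⟨(f 0, Sum.inl ⟨Fin.tail f, ht⟩), ?_⟩
      apply Subtype.ext
      exact Fin.cons_self_tail f
    · have key : ∀ i : Fin n, f i.succ ≠ f 0 := by
        intro i hi
        apply ht
        intro b
        obtain ⟨j, hj⟩ := hf b
        rcases Fin.eq_zero_or_eq_succ j with rfl | ⟨j, rfl⟩
        · exact ⟨i, hi.trans hj⟩
        · exact ⟨j, hj⟩
      choose h hh using fun i => Fin.exists_succAbove_eq (key i)
      refine ⟨(f 0, Sum.inr ⟨h, ?_⟩), ?_⟩
      · intro c
        obtain ⟨j, hj⟩ := hf ((f 0).succAbove c)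
        rcases Fin.eq_zero_or_eq_succ j with rfl | ⟨j, rfl⟩
        · exact absurd hj.symm (Fin.succAbove_ne _ _)
        · exact ⟨j, Fin.succAbove_right_injective ((hh j).trans hj)⟩
      · apply Subtype.ext
        have : (f 0).succAbove ∘ h = Fin.tail f := funext hh
        change (Fin.cons (f 0) ((f 0).succAbove ∘ h) : Fin (n+1) → Fin (k+1)) = f
        rw [this]
        exact Fin.cons_self_tail f

theorem card_surj (n k : ℕ) : Nat.card {f : Fin n → Fin k // Function.Surjective f} =
    k.factorial * Nat.stirlingSecond n k := by
  induction n generalizing k with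
  | zero =>
    cases k with
    | zero =>
      have : Function.Surjective (default : Fin 0 → Fin 0) := fun b => b.elim0
      have : Nonempty {f : Fin 0 → Fin 0 // Function.Surjective f} := ⟨⟨_, this⟩⟩
      have : Subsingleton {f : Fin 0 → Fin 0 // Function.Surjective f} := inferInstance
      exact Nat.card_eq_one_iff_unique.mpr ⟨inferInstance, inferInstance⟩
    | succ k =>
      have : IsEmpty {f : Fin 0 → Fin (k+1) // Function.Surjective f} :=
        ⟨fun f => by obtain ⟨i, _⟩ := f.2 0; exact i.elim0⟩
      simp
  | succ n ih =>
    cases k with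
    | zero =>
      have : IsEmpty {f : Fin (n+1) → Fin 0 // Function.Surjective f} :=
        ⟨fun f => (f.1 0).elim0⟩
      simp
    | succ k =>
      rw [← Nat.card_congr (Equiv.ofBijective _ (surjMap_bij n k)), Nat.card_prod, Nat.card_sum,
        ih, ih, Nat.stirlingSecond_succ_succ, Nat.card_fin, Nat.factorial_succ]
      ring

theorem stirlingSnd_eq (n k : ℕ) : stirlingSnd n k = Nat.stirlingSecond n k := by
  rw [stirlingSnd, card_surj, Nat.mul_div_cancel_left _ (Nat.factorial_pos k)]

theorem second_two (n : ℕ) : (Nat.stirlingSecond (n+1) 2 : ℚ) = 2^n - 1 := by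
  induction n with
  | zero => norm_num [Nat.stirlingSecond]
  | succ n ih =>
    rw [Nat.stirlingSecond_succ_succ, Nat.stirlingSecond_one_right]
    push_cast
    rw [ih]; ring

theorem second_three (n : ℕ) : (Nat.stirlingSecond (n+1) 3 : ℚ) = (3^n - 2*2^n + 1)/2 := by
  induction n with
  | zero => norm_num [Nat.stirlingSecond]
  | succ n ih =>
    rw [Nat.stirlingSecond_succ_succ]
    push_cast
    rw [ih, second_two]; ring

theorem second_four (n : ℕ) :
    (Nat.stirlingSecond (n+1) 4 : ℚ) = (4^n - 3*3^n + 3*2^n - 1)/6 := by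
  induction n with
  | zero => norm_num [Nat.stirlingSecond]
  | succ n ih =>
    rw [Nat.stirlingSecond_succ_succ]
    push_cast
    rw [ih, second_three]; ring

theorem multiset_two_excess (m : Multiset ℕ) (h2 : ∀ a ∈ m, 2 ≤ a) (h : m.sum = m.card + 2) :
    m = {3} ∨ m = {2, 2} := by
  have hle : ∀ s : Multiset ℕ, (∀ a ∈ s, 2 ≤ a) → s.card * 2 ≤ s.sum := by
    intro s hs
    simpa using Multiset.card_nsmul_le_sum hs
  induction m using Multiset.induction_on with
  | empty => simp at h
  | cons a s _ =>
    have ha := h2 a (by simp)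
    have hs : ∀ b ∈ s, 2 ≤ b := fun b hb => h2 b (by simp [hb])
    have hl := hle s hs
    simp only [Multiset.sum_cons, Multiset.card_cons] at h
    induction s using Multiset.induction_on with
    | empty =>
      left
      simp at h
      simp [h]
    | cons b t _ =>
      have hb := hs b (by simp)
      have ht := hle t fun c hc => hs c (by simp [hc])
      simp only [Multiset.sum_cons, Multiset.card_cons] at h
      have : t.card = 0 := by omega
      have h0 := Multiset.card_eq_zero.mp this
      subst h0
      simp at h
      right
      have : a = 2 := by omega
      have : b = 2 := by omega
      subst a b
      rfl

theorem cycleCount_iff {n : ℕ} (hn : 1 ≤ n) (σ : Equiv.Perm (Fin n)) :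
    cycleCount σ = n - 2 ↔ (σ.cycleType = {3} ∨ σ.cycleType = {2, 2}) := by
  have h1 : σ.cycleType.sum + (Finset.univ.filter fun x => σ x = x).card = n := by
    rw [Equiv.Perm.sum_cycleType]
    have := Finset.card_filter_add_card_filter_not (s := (Finset.univ : Finset (Fin n)))
      (fun x => σ x = x)
    rw [Finset.card_univ, Fintype.card_fin] at this
    rw [add_comm]
    convert this using 3
    ext x
    simp
  rw [cycleCount]
  constructor
  · intro h
    apply multiset_two_excess _ (fun a ha => Equiv.Perm.two_le_of_mem_cycleType ha)
    rcases Nat.lt_or_ge n 2 with h' | h'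
    · exfalso
      have : σ.cycleType.card = 0 := by omega
      have := Multiset.card_eq_zero.mp this
      rw [this] at h1 h
      simp only [Multiset.sum_zero, Multiset.card_zero] at h1 h
      omega
    · omega
  · rintro (h | h) <;> rw [h] at h1 ⊢ <;> simp at h1 ⊢ <;> omega

theorem card_three (n : ℕ) :
    ((Finset.univ.filter fun σ : Equiv.Perm (Fin n) => σ.cycleType = {3}).card : ℚ) =
      n*(n-1)*(n-2)/3 := by
  have h := Equiv.Perm.card_of_cycleType_mul_eq (Fin n) {3}
  simp only [Fintype.card_fin, Multiset.sum_singleton, Multiset.prod_singleton] at h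
  rcases Nat.lt_or_ge n 3 with h' | h'
  · rw [if_neg (by omega)] at h
    have : (Finset.univ.filter fun σ : Equiv.Perm (Fin n) => σ.cycleType = {3}).card = 0 := by
      rw [Equiv.Perm.card_of_cycleType_eq_zero_iff]
      simp; omega
    rw [this]
    interval_cases n <;> norm_num
  · rw [if_pos (by simpa using h')] at h
    obtain ⟨m, rfl⟩ := Nat.exists_eq_add_of_le' h'
    simp only [Nat.add_sub_cancel, Nat.factorial_succ] at h
    have hm : (m.factorial : ℚ) ≠ 0 := by exact_mod_cast m.factorial_ne_zero
    simp at h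
    have h2 := congrArg (Nat.cast : ℕ → ℚ) h
    push_cast at h2 ⊢
    apply mul_right_cancel₀ hm
    linear_combination h2 / 3

theorem card_two_two (n : ℕ) :
    ((Finset.univ.filter fun σ : Equiv.Perm (Fin n) => σ.cycleType = {2, 2}).card : ℚ) =
      n*(n-1)*(n-2)*(n-3)/8 := by
  have h := Equiv.Perm.card_of_cycleType_mul_eq (Fin n) {2, 2}
  have e1 : ({2, 2} : Multiset ℕ).sum = 4 := by decide
  have e2 : ({2, 2} : Multiset ℕ).prod = 4 := by decide
  have e3 : ∏ n ∈ ({2, 2} : Multiset ℕ).toFinset, (({2, 2} : Multiset ℕ).count n).factorial = 2 := by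
    decide
  rw [e1, e2, e3] at h
  simp only [Fintype.card_fin] at h
  rcases Nat.lt_or_ge n 4 with h' | h'
  · have : (Finset.univ.filter fun σ : Equiv.Perm (Fin n) => σ.cycleType = {2, 2}).card = 0 := by
      rw [Equiv.Perm.card_of_cycleType_eq_zero_iff]
      simp; omega
    rw [this]
    interval_cases n <;> norm_num
  · rw [if_pos (by simpa using h')] at h
    obtain ⟨m, rfl⟩ := Nat.exists_eq_add_of_le' h'
    simp only [Nat.add_sub_cancel, Nat.factorial_succ] at h
    have hm : (m.factorial : ℚ) ≠ 0 := by exact_mod_cast m.factorial_ne_zero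
    have h2 := congrArg (Nat.cast : ℕ → ℚ) h
    push_cast at h2 ⊢
    apply mul_right_cancel₀ hm
    linear_combination h2 / 8

theorem stirlingFst_eq (n : ℕ) (hn : 1 ≤ n) : (stirlingFst n (n - 2) : ℚ) =
    n*(n-1)*(n-2)/3 + n*(n-1)*(n-2)*(n-3)/8 := by
  classical
  rw [← card_three, ← card_two_two, stirlingFst, Nat.card_eq_fintype_card, Fintype.card_subtype,
    ← Nat.cast_add, ← Finset.card_union_of_disjoint]
  · congr 2
    ext σ
    simp [cycleCount_iff hn]
  · rw [Finset.disjoint_filter]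
    intro σ _ h h'
    rw [h] at h'
    exact absurd h' (by decide)

theorem final_aux (f : ℕ → ℚ) (h0 : f 0 = 0)
   (h : ∀ n : ℕ, 1 ≤ n → f n = (n:ℚ)*(n-1)*(n-2)/3 + n*(n-1)*(n-2)*(n-3)/8
     - n*(n-1)/2 * (2^n/4 - 1) + (4^n - 6*2^n+8)/24) :
    (1 - PowerSeries.X) ^ 5 * (1 - 2 * PowerSeries.X) ^ 3 * (1 - 4 * PowerSeries.X) *
        PowerSeries.mk f =
      15 * PowerSeries.X ^ 6 - 50 * PowerSeries.X ^ 7 + 40 * PowerSeries.X ^ 8 +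
        4 * (PowerSeries.X : PowerSeries ℚ) ^ 9 := by
  have e : (1 - PowerSeries.X) ^ 5 * (1 - 2 * PowerSeries.X) ^ 3 * (1 - 4 * PowerSeries.X) *
        PowerSeries.mk f = PowerSeries.mk f * (1 - (PowerSeries.C 15) * PowerSeries.X ^ 1
         + (PowerSeries.C 96) * PowerSeries.X ^ 2 - (PowerSeries.C 346) * PowerSeries.X ^ 3
         + (PowerSeries.C 777) * PowerSeries.X ^ 4 - (PowerSeries.C 1131) * PowerSeries.X ^ 5
         + (PowerSeries.C 1070) * PowerSeries.X ^ 6 - (PowerSeries.C 636) * PowerSeries.X ^ 7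
         + (PowerSeries.C 216) * PowerSeries.X ^ 8 - (PowerSeries.C 32) * PowerSeries.X ^ 9) := by
    simp only [map_ofNat]
    ring
  have e2 : 15 * PowerSeries.X ^ 6 - 50 * PowerSeries.X ^ 7 + 40 * PowerSeries.X ^ 8 +
        4 * (PowerSeries.X : PowerSeries ℚ) ^ 9 = (PowerSeries.C 15) * PowerSeries.X ^ 6 - (PowerSeries.C 50) * PowerSeries.X ^ 7 + (PowerSeries.C 40) * PowerSeries.X ^ 8 +
        (PowerSeries.C 4) * (PowerSeries.X : PowerSeries ℚ) ^ 9 := by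
    simp only [map_ofNat]
  rw [e, e2]
  ext n
  simp only [mul_add, mul_sub, mul_one, mul_left_comm (PowerSeries.mk f), map_add, map_sub, PowerSeries.coeff_C_mul,
    PowerSeries.coeff_mul_X_pow', PowerSeries.coeff_mk]
  rcases lt_or_ge n 10 with hn | hn
  · have h1 := h 1 (by norm_num)
    have h2 := h 2 (by norm_num)
    have h3 := h 3 (by norm_num)
    have h4 := h 4 (by norm_num)
    have h5 := h 5 (by norm_num)
    have h6 := h 6 (by norm_num)
    have h7 := h 7 (by norm_num)
    have h8 := h 8 (by norm_num)
    have h9 := h 9 (by norm_num)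
    interval_cases n <;> norm_num [h0, h1, h2, h3, h4, h5, h6, h7, h8, h9]
  · obtain ⟨m, rfl⟩ := Nat.exists_eq_add_of_le' hn
    have g : ∀ i, i ≤ 9 → m + 10 - i = m + (10 - i) := by omega
    have k : ∀ i, i ≤ 9 → (i ≤ m + 10) := by omega
    simp only [g 1 (by norm_num), g 2 (by norm_num), g 3 (by norm_num), g 4 (by norm_num),
     g 5 (by norm_num), g 6 (by norm_num), g 7 (by norm_num), g 8 (by norm_num), g 9 (by norm_num),
     k 1 (by norm_num), k 2 (by norm_num), k 3 (by norm_num), k 4 (by norm_num),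
     k 5 (by norm_num), k 6 (by norm_num), k 7 (by norm_num), k 8 (by norm_num), k 9 (by norm_num), if_true]
    have c : ∀ (i : ℕ) (q : ℚ), PowerSeries.coeff (m + (i + 1)) (PowerSeries.C q) = 0 := by
      intro i q
      rw [PowerSeries.coeff_C, if_neg (by omega)]
    have c1 := c 0 4
    have c2 := c 1 40
    have c3 := c 2 50
    have c4 := c 3 15
    norm_num only at c1 c2 c3 c4
    norm_num only
    rw [c1, c2, c3, c4]
    rw [h, h, h, h, h, h, h, h, h, h] <;> try omega
    push_cast
    norm_num only
    generalize hA : (m:ℚ) = x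
    simp only [pow_add]
    generalize (2:ℚ)^m = y
    generalize (4:ℚ)^m = z
    ring

theorem braid_closed (n : ℕ) (hn : 1 ≤ n) :
    braidKLdim2 n = (n:ℚ)*(n-1)*(n-2)/3 + n*(n-1)*(n-2)*(n-3)/8
     - n*(n-1)/2 * (2^n/4 - 1) + (4^n - 6*2^n+8)/24 := by
  rw [braidKLdim2, stirlingFst_eq n hn]
  simp only [stirlingSnd_eq]
  obtain ⟨m, rfl⟩ := Nat.exists_eq_add_of_le' hn
  rw [second_three, second_four, Nat.add_sub_cancel, Nat.stirlingSecond_succ_self_left,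
    Nat.cast_choose_two]
  cases m with
  | zero => norm_num
  | succ k =>
    rw [second_two]
    push_cast
    ring

/-- **Statement 18**: as formal power series,
`(1−u)⁵(1−2u)³(1−4u) · ∑_{n≥1} aₙ uⁿ = 15u⁶ − 50u⁷ + 40u⁸ + 4u⁹`. -/
theorem ogf_braid_KL_degree_two :
    (1 - PowerSeries.X) ^ 5 * (1 - 2 * PowerSeries.X) ^ 3 * (1 - 4 * PowerSeries.X) *
        PowerSeries.mk (fun n => if n = 0 then 0 else braidKLdim2 n) =
      15 * PowerSeries.X ^ 6 - 50 * PowerSeries.X ^ 7 + 40 * PowerSeries.X ^ 8 +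
        4 * (PowerSeries.X : PowerSeries ℚ) ^ 9 := by
  apply final_aux
  · simp
  · intro n hn
    rw [if_neg (by omega)]
    exact braid_closed n hn
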